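/- For every θ ∈ V*, the tensor T^θ defined by T^θ_{XYZ} = ⟨X,Y⟩θ(Z) − ⟨X,Z⟩θ(Y) + Σ_{a=1}^3 (⟨X,J_aY⟩θ(J_aZ) − ⟨X,J_aZ⟩θ(J_aY)) belongs to 𝒱̂ and satisfies L(T^θ) = 2T^θ (so T^θ ∈ 𝒱̂²); moreover c₁₂(T^θ) is a nonzero positive constant multiple of θ (the constant depending only on n), and A(T^θ) = T^{θ∘A⁻¹} for every Sp(n)Sp(1)-transformation A. -/

import Mathlib

open scoped RealInnerProductSpace

noncomputable section

/-- Trilinear forms on `V`. -/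
abbrev Tri (V : Type) [NormedAddCommGroup V] [InnerProductSpace ℝ V] : Type :=
  V →ₗ[ℝ] V →ₗ[ℝ] V →ₗ[ℝ] ℝ

variable {V : Type} [NormedAddCommGroup V] [InnerProductSpace ℝ V]

/-- `(V, ⟨·,·⟩, J₁, J₂, J₃)` is a quaternion-Hermitian vector space: the `Jₐ` square to `-1`,
satisfy the quaternion relations, and are isometries. -/
def IsQH (J1 J2 J3 : V →ₗ[ℝ] V) : Prop :=
  (∀ X, J1 (J1 X) = -X) ∧ (∀ X, J2 (J2 X) = -X) ∧ (∀ X, J3 (J3 X) = -X) ∧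
  (∀ X, J1 (J2 X) = J3 X) ∧ (∀ X, J2 (J1 X) = -(J3 X)) ∧
  (∀ X, J2 (J3 X) = J1 X) ∧ (∀ X, J3 (J2 X) = -(J1 X)) ∧
  (∀ X, J3 (J1 X) = J2 X) ∧ (∀ X, J1 (J3 X) = -(J2 X)) ∧
  (∀ X Y, ⟪J1 X, J1 Y⟫ = ⟪X, Y⟫) ∧ (∀ X Y, ⟪J2 X, J2 Y⟫ = ⟪X, Y⟫) ∧
  (∀ X Y, ⟪J3 X, J3 Y⟫ = ⟪X, Y⟫)

/-- The space `𝒯(V)` of trilinear forms skew in the last two arguments. -/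
def calT : Set (Tri V) := {S | ∀ X Y Z, S X Y Z = - S X Z Y}

/-- The space `𝒱` of (pointwise) homogeneous quaternionic Kähler structures. -/
def calV (J1 J2 J3 : V →ₗ[ℝ] V) : Set (Tri V) :=
  {S | (∀ X Y Z, S X Y Z = - S X Z Y) ∧
    ∃ π1 π2 π3 : V →ₗ[ℝ] ℝ, ∀ X Y Z : V,
      (S X (J1 Y) (J1 Z) - S X Y Z
        = π3 X * ⟪J2 Y, J1 Z⟫ - π2 X * ⟪J3 Y, J1 Z⟫) ∧
      (S X (J2 Y) (J2 Z) - S X Y Z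
        = π1 X * ⟪J3 Y, J2 Z⟫ - π3 X * ⟪J1 Y, J2 Z⟫) ∧
      (S X (J3 Y) (J3 Z) - S X Y Z
        = π2 X * ⟪J1 Y, J3 Z⟫ - π1 X * ⟪J2 Y, J3 Z⟫)}

/-- The space `𝒱̌`. -/
def calVcheck (J1 J2 J3 : V →ₗ[ℝ] V) : Set (Tri V) :=
  {Θ | ∃ π1 π2 π3 : V →ₗ[ℝ] ℝ, ∀ X Y Z : V,
    Θ X Y Z = (1/2) * (π1 X * ⟪J1 Y, Z⟫ + π2 X * ⟪J2 Y, Z⟫ + π3 X * ⟪J3 Y, Z⟫)}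

/-- The space `𝒱̂`. -/
def calVhat (J1 J2 J3 : V →ₗ[ℝ] V) : Set (Tri V) :=
  {T | (∀ X Y Z, T X Y Z = - T X Z Y) ∧
    (∀ X Y Z, T X (J1 Y) (J1 Z) = T X Y Z) ∧
    (∀ X Y Z, T X (J2 Y) (J2 Z) = T X Y Z) ∧
    (∀ X Y Z, T X (J3 Y) (J3 Z) = T X Y Z)}

/-- Inner product of trilinear forms w.r.t. an orthonormal basis. -/
def tinner {n : ℕ} (e : OrthonormalBasis (Fin (4*n)) ℝ V) (S S' : Tri V) : ℝ :=
  ∑ r, ∑ s, ∑ t, S (e r) (e s) (e t) * S' (e r) (e s) (e t)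

/-- The trace `c₁₂` of a trilinear form w.r.t. an orthonormal basis. -/
def c12 {n : ℕ} (e : OrthonormalBasis (Fin (4*n)) ℝ V) (S : Tri V) (Z : V) : ℝ :=
  ∑ r, S (e r) (e r) Z

/-- `A` is an `Sp(n)Sp(1)`-transformation: an orthogonal map with
`A ∘ Jₐ = Σ_b mₐᵇ J_b ∘ A` for some `m ∈ SO(3)`. -/
def IsSpnSp1 (J1 J2 J3 : V →ₗ[ℝ] V) (A : V ≃ₗᵢ[ℝ] V) : Prop :=
  ∃ m : Matrix (Fin 3) (Fin 3) ℝ, m.transpose * m = 1 ∧ m.det = 1 ∧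
    (∀ X, A (J1 X) = m 0 0 • J1 (A X) + m 0 1 • J2 (A X) + m 0 2 • J3 (A X)) ∧
    (∀ X, A (J2 X) = m 1 0 • J1 (A X) + m 1 1 • J2 (A X) + m 1 2 • J3 (A X)) ∧
    (∀ X, A (J3 X) = m 2 0 • J1 (A X) + m 2 1 • J2 (A X) + m 2 2 • J3 (A X))

/-- Action of an isometry on trilinear forms: `(A(S))_{XYZ} = S_{A⁻¹X,A⁻¹Y,A⁻¹Z}`. -/
def act (A : V ≃ₗᵢ[ℝ] V) (S : Tri V) : Tri V :=
  ((S.comp A.symm.toLinearMap).compl₂ A.symm.toLinearMap).compr₂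
    (LinearMap.lcomp ℝ ℝ A.symm.toLinearMap)

@[simp] theorem act_apply (A : V ≃ₗᵢ[ℝ] V) (S : Tri V) (X Y Z : V) :
    act A S X Y Z = S (A.symm X) (A.symm Y) (A.symm Z) := rfl

/-- `(X,Y,Z) ↦ T(Z,X,Y)` as a trilinear form. -/
def cyc1 (T : Tri V) : Tri V := LinearMap.lflip.comp T.flip

@[simp] theorem cyc1_apply (T : Tri V) (X Y Z : V) : cyc1 T X Y Z = T Z X Y := rfl

/-- `(X,Y,Z) ↦ T(Y,Z,X)` as a trilinear form. -/
def cyc2 (T : Tri V) : Tri V := (LinearMap.lflip.comp T).flip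

@[simp] theorem cyc2_apply (T : Tri V) (X Y Z : V) : cyc2 T X Y Z = T Y Z X := rfl

/-- Precompose the second and third arguments of a trilinear form with `f`. -/
def precomp23 (T : Tri V) (f : V →ₗ[ℝ] V) : Tri V :=
  (T.compl₂ f).compr₂ (LinearMap.lcomp ℝ ℝ f)

@[simp] theorem precomp23_apply (T : Tri V) (f : V →ₗ[ℝ] V) (X Y Z : V) :
    precomp23 T f X Y Z = T X (f Y) (f Z) := rfl

/-- The operator `L` on trilinear forms:
`L(T)_{XYZ} = T_{ZXY} + T_{YZX} + Σₐ (T_{JₐZ,X,JₐY} + T_{JₐY,JₐZ,X})`. -/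
def Lmap (J1 J2 J3 : V →ₗ[ℝ] V) (T : Tri V) : Tri V :=
  cyc1 T + cyc2 T
    + precomp23 (cyc1 T) J1 + precomp23 (cyc1 T) J2 + precomp23 (cyc1 T) J3
    + precomp23 (cyc2 T) J1 + precomp23 (cyc2 T) J2 + precomp23 (cyc2 T) J3

theorem Lmap_apply (J1 J2 J3 : V →ₗ[ℝ] V) (T : Tri V) (X Y Z : V) :
    Lmap J1 J2 J3 T X Y Z
      = T Z X Y + T Y Z X
        + (T (J1 Z) X (J1 Y) + T (J1 Y) (J1 Z) X)
        + (T (J2 Z) X (J2 Y) + T (J2 Y) (J2 Z) X)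
        + (T (J3 Z) X (J3 Y) + T (J3 Y) (J3 Z) X) := by
  simp [Lmap]; ring

/-- The space `𝒱̌₀^⊥ = 𝒬𝒦₁`. -/
def calVcheck0perp (J1 J2 J3 : V →ₗ[ℝ] V) : Set (Tri V) :=
  {Θ | ∃ θ : V →ₗ[ℝ] ℝ, ∀ X Y Z : V,
    Θ X Y Z = θ (J1 X) * ⟪J1 Y, Z⟫ + θ (J2 X) * ⟪J2 Y, Z⟫ + θ (J3 X) * ⟪J3 Y, Z⟫}

/-- The space `𝒱̌₀ = 𝒬𝒦₂`. -/
def calVcheck0 (J1 J2 J3 : V →ₗ[ℝ] V) : Set (Tri V) :=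
  {Θ | ∃ π1 π2 π3 : V →ₗ[ℝ] ℝ,
    (∀ X Y Z : V, Θ X Y Z = π1 X * ⟪J1 Y, Z⟫ + π2 X * ⟪J2 Y, Z⟫ + π3 X * ⟪J3 Y, Z⟫) ∧
    (∀ X : V, π1 (J1 X) + π2 (J2 X) + π3 (J3 X) = 0)}

/-- The values of the tensor `T^θ`. -/
def TthetaForm (J1 J2 J3 : V →ₗ[ℝ] V) (θ : V →ₗ[ℝ] ℝ) (X Y Z : V) : ℝ :=
  ⟪X, Y⟫ * θ Z - ⟪X, Z⟫ * θ Y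
    + (⟪X, J1 Y⟫ * θ (J1 Z) - ⟪X, J1 Z⟫ * θ (J1 Y))
    + (⟪X, J2 Y⟫ * θ (J2 Z) - ⟪X, J2 Z⟫ * θ (J2 Y))
    + (⟪X, J3 Y⟫ * θ (J3 Z) - ⟪X, J3 Z⟫ * θ (J3 Y))

/-- The space `𝒱̂₀^⊥ = 𝒬𝒦₃ = {T^θ : θ ∈ V*}`. -/
def TthetaSet (J1 J2 J3 : V →ₗ[ℝ] V) : Set (Tri V) :=
  {T | ∃ θ : V →ₗ[ℝ] ℝ, ∀ X Y Z : V, T X Y Z = TthetaForm J1 J2 J3 θ X Y Z}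

/-- The space `𝒬𝒦₄`. -/
def QK4set (J1 J2 J3 : V →ₗ[ℝ] V) {n : ℕ} (e : OrthonormalBasis (Fin (4*n)) ℝ V) :
    Set (Tri V) :=
  {T | T ∈ calVhat J1 J2 J3 ∧
    (∀ X Y Z : V, T X Y Z = (1/6) * ((T X Y Z + T Y Z X + T Z X Y)
      + (T X (J1 Y) (J1 Z) + T (J1 Y) (J1 Z) X + T (J1 Z) X (J1 Y))
      + (T X (J2 Y) (J2 Z) + T (J2 Y) (J2 Z) X + T (J2 Z) X (J2 Y))
      + (T X (J3 Y) (J3 Z) + T (J3 Y) (J3 Z) X + T (J3 Z) X (J3 Y)))) ∧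
    (∀ Z, c12 e T Z = 0)}

/-- The space `𝒬𝒦₅`. -/
def QK5set (J1 J2 J3 : V →ₗ[ℝ] V) : Set (Tri V) :=
  {T | T ∈ calVhat J1 J2 J3 ∧ ∀ X Y Z : V, T X Y Z + T Y Z X + T Z X Y = 0}

/-- An isometry squaring to `-1` is skew-adjoint. -/
theorem inner_map_left_of_isometry {J : V →ₗ[ℝ] V} (hsq : ∀ X, J (J X) = -X)
    (hiso : ∀ X Y, ⟪J X, J Y⟫ = ⟪X, Y⟫) (X Y : V) : ⟪J X, Y⟫ = -⟪X, J Y⟫ := by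
  rw [← hiso X (J Y), hsq, inner_neg_right, neg_neg]

theorem mem_calVhat_of_eq_TthetaForm {J1 J2 J3 : V →ₗ[ℝ] V} (hQH : IsQH J1 J2 J3)
    {θ : V →ₗ[ℝ] ℝ} {T : Tri V} (hT : ∀ X Y Z, T X Y Z = TthetaForm J1 J2 J3 θ X Y Z) :
    T ∈ calVhat J1 J2 J3 := by
  obtain ⟨h11, h22, h33, h12, h21, h23, h32, h31, h13, -, -, -⟩ := hQH
  refine ⟨fun X Y Z => ?_, fun X Y Z => ?_, fun X Y Z => ?_, fun X Y Z => ?_⟩ <;>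
  · simp only [hT, TthetaForm, h11, h22, h33, h12, h21, h23, h32, h31, h13, inner_neg_right,
      map_neg]
    ring

theorem Lmap_eq_two_smul_of_eq_TthetaForm {J1 J2 J3 : V →ₗ[ℝ] V} (hQH : IsQH J1 J2 J3)
    {θ : V →ₗ[ℝ] ℝ} {T : Tri V} (hT : ∀ X Y Z, T X Y Z = TthetaForm J1 J2 J3 θ X Y Z) :
    Lmap J1 J2 J3 T = (2 : ℝ) • T := by
  obtain ⟨h11, h22, h33, h12, h21, h23, h32, h31, h13, hi1, hi2, hi3⟩ := hQH
  ext X Y Z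
  simp only [Lmap_apply, LinearMap.smul_apply, smul_eq_mul, hT, TthetaForm,
    inner_map_left_of_isometry h11 hi1, inner_map_left_of_isometry h22 hi2,
    inner_map_left_of_isometry h33 hi3, h11, h22, h33, h12, h21, h23, h32, h31, h13,
    inner_neg_right, map_neg]
  have swap {J : V →ₗ[ℝ] V} (hsq : ∀ X, J (J X) = -X) (hiso : ∀ X Y, ⟪J X, J Y⟫ = ⟪X, Y⟫)
      (W : V) : ⟪W, J X⟫ = -⟪X, J W⟫ := by
    rw [real_inner_comm, inner_map_left_of_isometry hsq hiso]
  simp only [swap h11 hi1, swap h22 hi2, swap h33 hi3, real_inner_comm X Y, real_inner_comm X Z,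
    real_inner_comm Y Z]
  ring

theorem OrthonormalBasis.sum_inner_mul_map {ι : Type*} [Fintype ι] (e : OrthonormalBasis ι ℝ V)
    (φ : V →ₗ[ℝ] ℝ) (W : V) : ∑ r, ⟪e r, W⟫ * φ (e r) = φ W := by
  conv_rhs => rw [← e.sum_repr' W]
  simp

theorem c12_of_eq_TthetaForm {J1 J2 J3 : V →ₗ[ℝ] V} (hQH : IsQH J1 J2 J3)
    {n : ℕ} (e : OrthonormalBasis (Fin (4 * n)) ℝ V)
    {θ : V →ₗ[ℝ] ℝ} {T : Tri V} (hT : ∀ X Y Z, T X Y Z = TthetaForm J1 J2 J3 θ X Y Z) (Z : V) :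
    c12 e T Z = (4 * n + 2) * θ Z := by
  obtain ⟨h11, h22, h33, -, -, -, -, -, -, hi1, hi2, hi3⟩ := hQH
  have inner_self_map {J : V →ₗ[ℝ] V} (hsq : ∀ X, J (J X) = -X)
      (hiso : ∀ X Y, ⟪J X, J Y⟫ = ⟪X, Y⟫) (X : V) : ⟪X, J X⟫ = 0 := by
    have := inner_map_left_of_isometry hsq hiso X X
    rw [real_inner_comm] at this
    linarith
  have sum_map {J : V →ₗ[ℝ] V} (hsq : ∀ X, J (J X) = -X) :
      ∑ r, ⟪e r, J Z⟫ * θ (J (e r)) = -θ Z := by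
    simpa [hsq] using e.sum_inner_mul_map (θ.comp J) (J Z)
  simp only [c12, hT, TthetaForm, inner_self_map h11 hi1, inner_self_map h22 hi2,
    inner_self_map h33 hi3, Finset.sum_add_distrib, Finset.sum_sub_distrib, zero_mul,
    sum_map h11, sum_map h22, sum_map h33, e.sum_inner_mul_map, OrthonormalBasis.inner_eq_one]
  simp
  ring

theorem act_of_eq_TthetaForm {J1 J2 J3 : V →ₗ[ℝ] V} {θ : V →ₗ[ℝ] ℝ} {T : Tri V}
    (hT : ∀ X Y Z, T X Y Z = TthetaForm J1 J2 J3 θ X Y Z) {A : V ≃ₗᵢ[ℝ] V}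
    (hA : IsSpnSp1 J1 J2 J3 A) (X Y Z : V) :
    act A T X Y Z = TthetaForm J1 J2 J3 (θ.comp A.symm.toLinearMap) X Y Z := by
  obtain ⟨m, hm, -, hA1, hA2, hA3⟩ := hA
  obtain ⟨φ, rfl⟩ : ∃ φ : V →ₗ[ℝ] ℝ, θ = φ.comp A.toLinearMap :=
    ⟨θ.comp A.symm.toLinearMap, by ext; simp⟩
  obtain ⟨X, rfl⟩ := A.surjective X
  obtain ⟨Y, rfl⟩ := A.surjective Y
  obtain ⟨Z, rfl⟩ := A.surjective Z
  have inner_eq (U W : V) : ⟪U, W⟫ = ⟪A U, A W⟫ := (A.inner_map_map U W).symm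
  have entry (i j : Fin 3) := congrFun (congrFun hm i) j
  simp only [Matrix.mul_apply, Matrix.transpose_apply, Fin.sum_univ_three] at entry
  have e00 := entry 0 0
  have e01 := entry 0 1
  have e02 := entry 0 2
  have e11 := entry 1 1
  have e12 := entry 1 2
  have e22 := entry 2 2
  simp at e00 e01 e02 e11 e12 e22
  simp only [act_apply, hT, TthetaForm, LinearIsometryEquiv.symm_apply_apply]
  simp only [inner_eq X, hA1, hA2, hA3, LinearMap.comp_apply,
    LinearIsometryEquiv.coe_toLinearEquiv, LinearEquiv.coe_coe, inner_add_right,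
    inner_smul_right, map_add, map_smul, smul_eq_mul,
    LinearIsometryEquiv.apply_symm_apply]
  set p1 := ⟪A X, J1 (A Y)⟫
  set p2 := ⟪A X, J2 (A Y)⟫
  set p3 := ⟪A X, J3 (A Y)⟫
  set q1 := φ (J1 (A Z))
  set q2 := φ (J2 (A Z))
  set q3 := φ (J3 (A Z))
  set r1 := ⟪A X, J1 (A Z)⟫
  set r2 := ⟪A X, J2 (A Z)⟫
  set r3 := ⟪A X, J3 (A Z)⟫
  set s1 := φ (J1 (A Y))
  set s2 := φ (J2 (A Y))
  set s3 := φ (J3 (A Y))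
  linear_combination (p1 * q1 - r1 * s1) * e00 + (p2 * q2 - r2 * s2) * e11
    + (p3 * q3 - r3 * s3) * e22 + (p1 * q2 + p2 * q1 - r1 * s2 - r2 * s1) * e01
    + (p1 * q3 + p3 * q1 - r1 * s3 - r3 * s1) * e02
    + (p2 * q3 + p3 * q2 - r2 * s3 - r3 * s2) * e12

/-- for every `θ ∈ V*`, the tensor `T^θ` lies in `𝒱̂` and in the
`2`-eigenspace of `L`; `c₁₂(T^θ)` is a positive constant multiple of `θ` (the constant
depending only on `n`), and `A(T^θ) = T^{θ∘A⁻¹}` for every `Sp(n)Sp(1)`-transformation. -/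
theorem stmt11 (J1 J2 J3 : V →ₗ[ℝ] V) (hQH : IsQH J1 J2 J3)
    {n : ℕ} (hn : 1 ≤ n) (hdim : Module.finrank ℝ V = 4 * n)
    (e : OrthonormalBasis (Fin (4*n)) ℝ V) :
    ∃ c : ℝ, 0 < c ∧ ∀ (θ : V →ₗ[ℝ] ℝ) (T : Tri V),
      (∀ X Y Z : V, T X Y Z = TthetaForm J1 J2 J3 θ X Y Z) →
      T ∈ calVhat J1 J2 J3 ∧
      Lmap J1 J2 J3 T = (2 : ℝ) • T ∧
      (∀ Z, c12 e T Z = c * θ Z) ∧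
      (∀ A : V ≃ₗᵢ[ℝ] V, IsSpnSp1 J1 J2 J3 A → ∀ X Y Z : V,
        act A T X Y Z = TthetaForm J1 J2 J3 (θ.comp A.symm.toLinearMap) X Y Z) := by
  exact ⟨4 * n + 2, by positivity, fun θ T hT =>
    ⟨mem_calVhat_of_eq_TthetaForm hQH hT, Lmap_eq_two_smul_of_eq_TthetaForm hQH hT,
      c12_of_eq_TthetaForm hQH e hT, fun A hA => act_of_eq_TthetaForm hT hA⟩⟩

end
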